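/- arXiv:2012.12737 — 10 statements merged into one kernel-verified Lean document; each statement's English description precedes it below -/
import Mathlib

section
/- Let Ω ⊆ ℝ^n be a nonempty closed convex set, let x̄ ∈ Ω be such that Ω \ {x̄} is nonempty, and let g ∈ ℝ^n. Then max{0, sup_{h ∈ Ω, h ≠ x̄} ⟨g, (h − x̄)/‖h − x̄‖⟩} = dist(N_Ω(x̄), g) = ‖π(T_Ω(x̄), g)‖. -/
open Set Metric RealInnerProductSpace

noncomputable section

/-- The tangent cone to a convex set `Ω` at `x`: the closure of the cone of feasible
directions. -/
def tangentCone {n : ℕ} (Ω : Set (EuclideanSpace ℝ (Fin n))) (x : EuclideanSpace ℝ (Fin n)) :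
    Set (EuclideanSpace ℝ (Fin n)) :=
  closure {w | ∃ l : ℝ, 0 < l ∧ x + l • w ∈ Ω}

/-- The normal cone to a convex set `Ω` at `x`. -/
def normalCone {n : ℕ} (Ω : Set (EuclideanSpace ℝ (Fin n))) (x : EuclideanSpace ℝ (Fin n)) :
    Set (EuclideanSpace ℝ (Fin n)) :=
  {v | ∀ y ∈ Ω, ⟪v, y - x⟫ ≤ 0}

/-- `p` is the Euclidean (metric) projection of `g` onto the set `C`. -/
def IsProjection {n : ℕ} (C : Set (EuclideanSpace ℝ (Fin n)))
    (g p : EuclideanSpace ℝ (Fin n)) : Prop :=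
  p ∈ C ∧ ∀ w ∈ C, ‖g - p‖ ≤ ‖g - w‖

/-- The directions from `x` that stay in a convex set `Ω` for some positive length form a convex
set. -/
theorem convex_feasibleDirections {n : ℕ} {Ω : Set (EuclideanSpace ℝ (Fin n))}
    (hΩ : Convex ℝ Ω) {x : EuclideanSpace ℝ (Fin n)} (hx : x ∈ Ω) :
    Convex ℝ {w : EuclideanSpace ℝ (Fin n) | ∃ l : ℝ, 0 < l ∧ x + l • w ∈ Ω} := by
  have shrink : ∀ (w : EuclideanSpace ℝ (Fin n)) (l m : ℝ), 0 < m → m ≤ l →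
      x + l • w ∈ Ω → x + m • w ∈ Ω := by
    intro w l m hm hml hw
    have hl : 0 < l := hm.trans_le hml
    have h := hΩ.add_smul_mem hx hw (t := m / l) ⟨by positivity, (div_le_one hl).2 hml⟩
    rwa [smul_smul, div_mul_cancel₀ _ hl.ne'] at h
  rintro u ⟨l, hl, hu⟩ v ⟨m, hm, hv⟩ a b ha hb hab
  have hmin : 0 < min l m := lt_min hl hm
  refine ⟨min l m, hmin, ?_⟩
  convert hΩ (shrink u l _ hmin (min_le_left _ _) hu) (shrink v m _ hmin (min_le_right _ _) hv)
    ha hb hab using 1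
  rw [smul_add, smul_add, smul_add, add_add_add_comm, ← add_smul, hab, one_smul,
    smul_comm a, smul_comm b]

theorem convex_tangentCone {n : ℕ} {Ω : Set (EuclideanSpace ℝ (Fin n))}
    (hΩ : Convex ℝ Ω) {x : EuclideanSpace ℝ (Fin n)} (hx : x ∈ Ω) :
    Convex ℝ (tangentCone Ω x) :=
  (convex_feasibleDirections hΩ hx).closure

theorem zero_mem_convexTangentCone {n : ℕ} {Ω : Set (EuclideanSpace ℝ (Fin n))}
    {x : EuclideanSpace ℝ (Fin n)} (hx : x ∈ Ω) : 0 ∈ tangentCone Ω x :=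
  subset_closure ⟨1, one_pos, by simpa using hx⟩

theorem sub_mem_tangentCone {n : ℕ} {Ω : Set (EuclideanSpace ℝ (Fin n))}
    {x y : EuclideanSpace ℝ (Fin n)} (hy : y ∈ Ω) : y - x ∈ tangentCone Ω x :=
  subset_closure ⟨1, one_pos, by simpa using hy⟩

theorem smul_mem_tangentCone {n : ℕ} {Ω : Set (EuclideanSpace ℝ (Fin n))}
    {x w : EuclideanSpace ℝ (Fin n)} {c : ℝ} (hc : 0 < c) (hw : w ∈ tangentCone Ω x) :
    c • w ∈ tangentCone Ω x := by
  refine map_mem_closure (continuous_const_smul c) hw ?_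
  rintro v ⟨l, hl, hv⟩
  refine ⟨l / c, by positivity, ?_⟩
  rwa [smul_smul, div_mul_cancel₀ _ hc.ne']

/-- A homogeneous linear bound on the displacements `y - x`, `y ∈ Ω`, extends to the tangent
cone. -/
theorem inner_le_mul_norm_of_mem_tangentCone {n : ℕ} {Ω : Set (EuclideanSpace ℝ (Fin n))}
    {x v w : EuclideanSpace ℝ (Fin n)} {M : ℝ}
    (h : ∀ y ∈ Ω, ⟪v, y - x⟫ ≤ M * ‖y - x‖) (hw : w ∈ tangentCone Ω x) :
    ⟪v, w⟫ ≤ M * ‖w‖ := by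
  have hcl : IsClosed {w : EuclideanSpace ℝ (Fin n) | ⟪v, w⟫ ≤ M * ‖w‖} :=
    isClosed_le (by fun_prop) (by fun_prop)
  refine closure_minimal ?_ hcl hw
  rintro u ⟨l, hl, hu⟩
  have h' := h _ hu
  rw [add_sub_cancel_left, inner_smul_right, norm_smul, Real.norm_of_nonneg hl.le,
    mul_left_comm] at h'
  exact le_of_mul_le_mul_left h' hl

theorem inner_nonpos_of_mem_normalCone {n : ℕ} {Ω : Set (EuclideanSpace ℝ (Fin n))}
    {x v w : EuclideanSpace ℝ (Fin n)} (hv : v ∈ normalCone Ω x) (hw : w ∈ tangentCone Ω x) :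
    ⟪v, w⟫ ≤ 0 := by
  simpa using inner_le_mul_norm_of_mem_tangentCone (M := 0) (by simpa [normalCone] using hv) hw

theorem IsProjection.inner_sub_le_zero {n : ℕ} {C : Set (EuclideanSpace ℝ (Fin n))}
    {g p w : EuclideanSpace ℝ (Fin n)} (hC : Convex ℝ C) (hp : IsProjection C g p)
    (hw : w ∈ C) : ⟪g - p, w - p⟫ ≤ 0 := by
  refine (norm_eq_iInf_iff_real_inner_le_zero hC hp.1).1 ?_ w hw
  have : Nonempty C := ⟨⟨p, hp.1⟩⟩
  refine le_antisymm (le_ciInf fun z => hp.2 z z.2) ?_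
  exact ciInf_le ⟨0, by rintro _ ⟨z, rfl⟩; positivity⟩ (⟨p, hp.1⟩ : C)

/-- The residual of the projection onto the tangent cone is orthogonal to the projection. -/
theorem IsProjection.inner_sub_self_eq_zero {n : ℕ} {Ω : Set (EuclideanSpace ℝ (Fin n))}
    {x g p : EuclideanSpace ℝ (Fin n)} (hΩ : Convex ℝ Ω) (hx : x ∈ Ω)
    (hp : IsProjection (tangentCone Ω x) g p) : ⟪g - p, p⟫ = 0 := by
  have h0 := hp.inner_sub_le_zero (convex_tangentCone hΩ hx) (zero_mem_convexTangentCone hx)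
  have h2 := hp.inner_sub_le_zero (convex_tangentCone hΩ hx)
    (smul_mem_tangentCone two_pos hp.1)
  rw [zero_sub, inner_neg_right] at h0
  rw [two_smul, add_sub_cancel_right] at h2
  linarith

/-- The residual of the projection onto the tangent cone lies in the normal cone. -/
theorem IsProjection.sub_mem_normalCone {n : ℕ} {Ω : Set (EuclideanSpace ℝ (Fin n))}
    {x g p : EuclideanSpace ℝ (Fin n)} (hΩ : Convex ℝ Ω) (hx : x ∈ Ω)
    (hp : IsProjection (tangentCone Ω x) g p) : g - p ∈ normalCone Ω x := by
  intro y hy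
  have h := hp.inner_sub_le_zero (convex_tangentCone hΩ hx) (sub_mem_tangentCone hy)
  rwa [inner_sub_right, hp.inner_sub_self_eq_zero hΩ hx, sub_zero] at h

/-- The distance to the normal cone is the norm of the projection onto the tangent cone. -/
theorem IsProjection.infDist_normalCone {n : ℕ} {Ω : Set (EuclideanSpace ℝ (Fin n))}
    {x g p : EuclideanSpace ℝ (Fin n)} (hΩ : Convex ℝ Ω) (hx : x ∈ Ω)
    (hp : IsProjection (tangentCone Ω x) g p) :
    Metric.infDist g (normalCone Ω x) = ‖p‖ := by
  have hq := hp.sub_mem_normalCone hΩ hx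
  refine le_antisymm ?_ ((Metric.le_infDist ⟨_, hq⟩).2 fun v hv => ?_)
  · simpa [dist_eq_norm] using Metric.infDist_le_dist_of_mem (x := g) hq
  · rw [dist_eq_norm]
    rcases (norm_nonneg p).eq_or_lt with h | h
    · rw [← h]
      positivity
    · refine le_of_mul_le_mul_right ?_ h
      have hv' := inner_nonpos_of_mem_normalCone hv hp.1
      have hgp := hp.inner_sub_self_eq_zero hΩ hx
      have hle := real_inner_le_norm (g - v) p
      rw [inner_sub_left] at hgp hle
      rw [real_inner_self_eq_norm_mul_norm] at hgp
      linarith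

/-- The support of `g` on unit feasible directions is the norm of the projection of `g` onto the
tangent cone. -/
theorem IsProjection.max_sSup_eq_norm {n : ℕ} {Ω : Set (EuclideanSpace ℝ (Fin n))}
    {x g p : EuclideanSpace ℝ (Fin n)} (hΩ : Convex ℝ Ω) (hx : x ∈ Ω)
    (hp : IsProjection (tangentCone Ω x) g p) :
    max 0 (sSup {r : ℝ | ∃ h ∈ Ω, h ≠ x ∧ r = ⟪g, ‖h - x‖⁻¹ • (h - x)⟫}) = ‖p‖ := by
  set S := {r : ℝ | ∃ h ∈ Ω, h ≠ x ∧ r = ⟪g, ‖h - x‖⁻¹ • (h - x)⟫}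
  have hS : ∀ r ∈ S, r ≤ ‖p‖ := by
    rintro r ⟨h, hh, hne, rfl⟩
    have hpos : 0 < ‖h - x‖ := norm_pos_iff.2 (sub_ne_zero.2 hne)
    have hq := hp.sub_mem_normalCone hΩ hx h hh
    have hle := real_inner_le_norm p (h - x)
    rw [inner_sub_left] at hq
    rw [inner_smul_right, inv_mul_le_iff₀ hpos]
    linarith
  refine le_antisymm (max_le (norm_nonneg p) (Real.sSup_le hS (norm_nonneg p))) ?_
  rcases (norm_nonneg p).eq_or_lt with h | h
  · rw [← h]
    exact le_max_left _ _
  · have hbound : ∀ y ∈ Ω, ⟪g, y - x⟫ ≤ max 0 (sSup S) * ‖y - x‖ := by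
      intro y hy
      rcases eq_or_ne y x with rfl | hne
      · simp
      · have hpos : 0 < ‖y - x‖ := norm_pos_iff.2 (sub_ne_zero.2 hne)
        have hle := (le_csSup ⟨‖p‖, hS⟩ (⟨y, hy, hne, rfl⟩ : _ ∈ S)).trans (le_max_right 0 _)
        rwa [inner_smul_right, inv_mul_le_iff₀ hpos, mul_comm] at hle
    have hgp := hp.inner_sub_self_eq_zero hΩ hx
    have hle := inner_le_mul_norm_of_mem_tangentCone hbound hp.1
    rw [inner_sub_left, real_inner_self_eq_norm_mul_norm] at hgp
    refine le_of_mul_le_mul_right ?_ h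
    linarith

/-- Proposition 2 of the paper: for a nonempty closed convex `Ω`,
`x̄ ∈ Ω` with `Ω \ {x̄}` nonempty and any `g`,
`max {0, sup_{h ∈ Ω, h ≠ x̄} ⟪g, (h - x̄)/‖h - x̄‖⟫} = dist(N_Ω(x̄), g) = ‖π(T_Ω(x̄), g)‖`. -/
theorem stmt0 {n : ℕ} (Ω : Set (EuclideanSpace ℝ (Fin n)))
    (hΩne : Ω.Nonempty) (hΩcl : IsClosed Ω) (hΩconv : Convex ℝ Ω)
    (xbar : EuclideanSpace ℝ (Fin n)) (hxbar : xbar ∈ Ω)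
    (hne : (Ω \ {xbar}).Nonempty)
    (g p : EuclideanSpace ℝ (Fin n))
    (hp : IsProjection (tangentCone Ω xbar) g p) :
    max 0 (sSup {r : ℝ | ∃ h ∈ Ω, h ≠ xbar ∧ r = ⟪g, ‖h - xbar‖⁻¹ • (h - xbar)⟫}) =
        Metric.infDist g (normalCone Ω xbar) ∧
      Metric.infDist g (normalCone Ω xbar) = ‖p‖ := by
  rw [hp.infDist_normalCone hΩconv hxbar]
  exact ⟨hp.max_sSup_eq_norm hΩconv hxbar, rfl⟩
end
end

section
/- Let C ⊆ ℝ^n be a nonempty closed convex cone and let y ∈ ℝ^n. Then dist(C*, y) = sup_{c ∈ C} ⟨ĉ, y⟩, where ĉ = c/‖c‖ for c ≠ 0 and 0̂ = 0, and C* = {v ∈ ℝ^n | ⟨v, c⟩ ≤ 0 for all c ∈ C} is the polar cone of C. -/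
open Set Metric RealInnerProductSpace

noncomputable section

/-- Moreau decomposition: every `y` has a point `p` in a nonempty closed convex cone `K` such that
`y - p` lies in the polar cone of `K` and is orthogonal to `p`. -/
theorem exists_mem_cone_sub_mem_polar {F : Type*} [NormedAddCommGroup F] [InnerProductSpace ℝ F]
    [CompleteSpace F] {K : Set F} (hne : K.Nonempty) (hclosed : IsClosed K)
    (hadd : ∀ x ∈ K, ∀ y ∈ K, x + y ∈ K) (hsmul : ∀ a : ℝ, 0 ≤ a → ∀ x ∈ K, a • x ∈ K) (y : F) :
    ∃ p ∈ K, (∀ c ∈ K, ⟪y - p, c⟫ ≤ 0) ∧ ⟪y - p, p⟫ = 0 := by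
  have hconv : Convex ℝ K := fun x hx z hz a b ha hb _ ↦
    hadd _ (hsmul a ha x hx) _ (hsmul b hb z hz)
  obtain ⟨p, hp, hmin⟩ := exists_norm_eq_iInf_of_complete_convex hne hclosed.isComplete hconv y
  have hvar := (norm_eq_iInf_iff_real_inner_le_zero hconv hp).1 hmin
  have hpolar : ∀ c ∈ K, ⟪y - p, c⟫ ≤ 0 := fun c hc ↦ by
    simpa using hvar (p + c) (hadd p hp c hc)
  refine ⟨p, hp, hpolar, le_antisymm (hpolar p hp) ?_⟩
  have h0 : (0 : F) ∈ K := by simpa using hsmul 0 le_rfl p hp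
  simpa using hvar 0 h0

/-- Proposition 7 of the paper: for a nonempty closed convex cone `C`
and any `y`, `dist(C*, y) = sup_{c ∈ C} ⟪ĉ, y⟫`, where `ĉ = c/‖c‖` (and `0̂ = 0`,
which is what `‖c‖⁻¹ • c` evaluates to at `c = 0`). -/
theorem stmt1 {n : ℕ} (C : Set (EuclideanSpace ℝ (Fin n)))
    (hadd : ∀ x ∈ C, ∀ y ∈ C, x + y ∈ C)
    (hsmul : ∀ (a : ℝ), 0 ≤ a → ∀ x ∈ C, a • x ∈ C)
    (y : EuclideanSpace ℝ (Fin n)) :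
    Metric.infDist y {v : EuclideanSpace ℝ (Fin n) | ∀ c ∈ C, ⟪v, c⟫ ≤ 0} =
      sSup {r : ℝ | ∃ c ∈ C, r = ⟪‖c‖⁻¹ • c, y⟫} := by
  rcases C.eq_empty_or_nonempty with rfl | hne
  · simp [infDist_zero_of_mem]
  set P : Set (EuclideanSpace ℝ (Fin n)) := {v | ∀ c ∈ C, ⟪v, c⟫ ≤ 0}
  set S : Set ℝ := {r | ∃ c ∈ C, r = ⟪‖c‖⁻¹ • c, y⟫}
  obtain ⟨p, hp, hpolar, horth⟩ := exists_mem_cone_sub_mem_polar hne.closure isClosed_closure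
    (fun x hx z hz ↦ map_mem_closure₂ continuous_add hx hz hadd)
    (fun a ha x hx ↦ map_mem_closure (continuous_const_smul a) hx (hsmul a ha)) y
  have hmem : y - p ∈ P := fun c hc ↦ hpolar c (subset_closure hc)
  have hle : ∀ r ∈ S, r ≤ infDist y P := by
    rintro _ ⟨c, hc, rfl⟩
    refine (le_infDist ⟨_, hmem⟩).2 fun v hv ↦ ?_
    have hvc : ⟪‖c‖⁻¹ • c, v⟫ ≤ 0 := by
      rw [real_inner_comm]
      exact hv _ (hsmul _ (by positivity) c hc)
    have hunit : ‖‖c‖⁻¹ • c‖ ≤ 1 := by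
      rw [norm_smul, norm_inv, norm_norm]
      exact inv_mul_le_one
    calc ⟪‖c‖⁻¹ • c, y⟫ ≤ ⟪‖c‖⁻¹ • c, y - v⟫ := by rw [inner_sub_right]; linarith
      _ ≤ ‖‖c‖⁻¹ • c‖ * ‖y - v‖ := real_inner_le_norm _ _
      _ ≤ dist y v := by
        rw [dist_eq_norm]
        exact mul_le_of_le_one_left (norm_nonneg _) hunit
  have hbdd : BddAbove S := ⟨_, hle⟩
  have hSne : S.Nonempty := hne.imp' (fun c ↦ ⟪‖c‖⁻¹ • c, y⟫) fun c hc ↦ ⟨c, hc, rfl⟩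
  refine le_antisymm ?_ (csSup_le hSne hle)
  have hdist : infDist y P ≤ ‖p‖ := by
    simpa [dist_eq_norm] using infDist_le_dist_of_mem (x := y) hmem
  have hS0 : 0 ≤ sSup S := by
    obtain ⟨c, hc⟩ := hne
    exact le_csSup hbdd ⟨0, by simpa using hsmul 0 le_rfl c hc, by simp⟩
  have hbound : ⟪p, y⟫ ≤ sSup S * ‖p‖ := by
    have hcl : IsClosed {c : EuclideanSpace ℝ (Fin n) | ⟪c, y⟫ ≤ sSup S * ‖c‖} :=
      isClosed_le (by fun_prop) (by fun_prop)
    refine closure_minimal (fun c hc ↦ ?_) hcl hp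
    rcases eq_or_ne c 0 with rfl | hc0
    · simp
    have h := le_csSup hbdd ⟨c, hc, rfl⟩
    rwa [real_inner_smul_left, inv_mul_le_iff₀ (norm_pos_iff.2 hc0), mul_comm] at h
  rw [real_inner_comm, ← sub_add_cancel y p, inner_add_left, horth, zero_add,
    real_inner_self_eq_norm_mul_norm] at hbound
  refine hdist.trans ?_
  rcases (norm_nonneg p).eq_or_lt with h | h
  · rwa [← h]
  · exact le_of_mul_le_mul_right hbound h
end
end

section
/- Let f : ℝ^n → ℝ be differentiable with L-Lipschitz gradient (L > 0). Let x ∈ ℝ^n, let d ∈ ℝ^n with d ≠ 0, and let α be a real number with 0 ≤ α ≤ ⟨−∇f(x), d⟩/(L‖d‖²). Then for x' = x + αd one has f(x) − f(x') ≥ (L/2)‖x' − x‖². -/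
open Set Metric RealInnerProductSpace

noncomputable section

/-- The descent lemma: a function with `L`-Lipschitz gradient lies below its quadratic model. -/
theorem le_quadratic_of_lipschitz_gradient {E : Type*} [NormedAddCommGroup E]
    [InnerProductSpace ℝ E] [CompleteSpace E] {f : E → ℝ} {L : ℝ}
    (hdiff : ∀ x, DifferentiableAt ℝ f x)
    (hlip : ∀ x y, ‖gradient f x - gradient f y‖ ≤ L * ‖x - y‖) (x v : E) :
    f (x + v) ≤ f x + ⟪gradient f x, v⟫ + L / 2 * ‖v‖ ^ 2 := by
  have hderiv : ∀ t : ℝ, HasDerivAt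
      (fun t : ℝ => f (x + t • v) - t * ⟪gradient f x, v⟫ - L / 2 * ‖v‖ ^ 2 * t ^ 2)
      (⟪gradient f (x + t • v), v⟫ - ⟪gradient f x, v⟫ - L * ‖v‖ ^ 2 * t) t := by
    intro t
    have hline : HasDerivAt (fun t : ℝ => x + t • v) v t := by
      simpa using ((hasDerivAt_id t).smul_const v).const_add x
    have hf : HasDerivAt (fun t : ℝ => f (x + t • v)) ⟪gradient f (x + t • v), v⟫ t := by
      have h := (hdiff (x + t • v)).hasGradientAt.hasFDerivAt.comp_hasDerivAt t hline
      rwa [InnerProductSpace.toDual_apply_apply] at h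
    have hlin := (hasDerivAt_id t).mul_const ⟪gradient f x, v⟫
    have hquad := ((hasDerivAt_id t).pow 2).const_mul (L / 2 * ‖v‖ ^ 2)
    refine HasDerivAt.congr_deriv ((hf.sub hlin).sub hquad) ?_
    norm_num
    ring
  have hanti := antitoneOn_of_deriv_nonpos (convex_Icc (0 : ℝ) 1)
    (fun t _ => (hderiv t).continuousAt.continuousWithinAt)
    (fun t _ => (hderiv t).differentiableAt.differentiableWithinAt) (by
      intro t ht
      rw [interior_Icc] at ht
      rw [(hderiv t).deriv, ← inner_sub_left]
      have hinner := real_inner_le_norm (gradient f (x + t • v) - gradient f x) v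
      have hnorm : ‖gradient f (x + t • v) - gradient f x‖ ≤ L * (t * ‖v‖) := by
        simpa [norm_smul, abs_of_pos ht.1] using hlip (x + t • v) x
      nlinarith [mul_le_mul_of_nonneg_right hnorm (norm_nonneg v)])
  have h := hanti (left_mem_Icc.2 zero_le_one) (right_mem_Icc.2 zero_le_one) zero_le_one
  simp only [one_smul, zero_smul, add_zero] at h
  linarith

/-- for an `L`-smooth `f`, a step `x' = x + α d` with
`0 ≤ α ≤ ⟪-∇f(x), d⟫ / (L ‖d‖²)` satisfies the sufficient decrease
`f(x) - f(x') ≥ (L/2) ‖x' - x‖²`. -/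
theorem stmt5 {n : ℕ} (f : EuclideanSpace ℝ (Fin n) → ℝ) (L : ℝ) (hL : 0 < L)
    (hdiff : ∀ x, DifferentiableAt ℝ f x)
    (hlip : ∀ x y, ‖gradient f x - gradient f y‖ ≤ L * ‖x - y‖)
    (x d : EuclideanSpace ℝ (Fin n)) (hd : d ≠ 0) (α : ℝ)
    (hα0 : 0 ≤ α) (hα1 : α ≤ ⟪-gradient f x, d⟫ / (L * ‖d‖ ^ 2)) :
    L / 2 * ‖(x + α • d) - x‖ ^ 2 ≤ f x - f (x + α • d) := by
  have hdesc := le_quadratic_of_lipschitz_gradient hdiff hlip x (α • d)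
  have hnorm : ‖α • d‖ ^ 2 = α ^ 2 * ‖d‖ ^ 2 := by
    rw [norm_smul, mul_pow, Real.norm_eq_abs, sq_abs]
  rw [real_inner_smul_right, hnorm] at hdesc
  have hd' : 0 < ‖d‖ := norm_pos_iff.2 hd
  rw [le_div_iff₀ (by positivity), inner_neg_left] at hα1
  rw [add_sub_cancel_left, hnorm]
  nlinarith [mul_le_mul_of_nonneg_left hα1 hα0]
end
end

section
/- Let f : ℝ^n → ℝ be differentiable with L-Lipschitz gradient (L > 0), let x̄ ∈ ℝ^n and set g = −∇f(x̄). Then every z in the closed ball of radius ‖g‖/(2L) centered at x̄ + g/(2L) satisfies f(z) ≤ f(x̄) − (L/2)‖z − x̄‖². -/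
open Set Metric RealInnerProductSpace

noncomputable section

/-- The descent lemma: a function with `L`-Lipschitz gradient lies below its quadratic upper
model at every point. -/
theorem le_add_inner_gradient_add_of_lipschitz_gradient {E : Type*} [NormedAddCommGroup E]
    [InnerProductSpace ℝ E] [CompleteSpace E] {f : E → ℝ} {L : ℝ}
    (hdiff : ∀ x, DifferentiableAt ℝ f x)
    (hlip : ∀ x y, ‖gradient f x - gradient f y‖ ≤ L * ‖x - y‖) (x d : E) :
    f (x + d) ≤ f x + ⟪gradient f x, d⟫ + L / 2 * ‖d‖ ^ 2 := by
  let h : ℝ → ℝ := fun t ↦ f (x + t • d) - t * ⟪gradient f x, d⟫ - t ^ 2 * (L / 2 * ‖d‖ ^ 2)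
  have hderiv (t : ℝ) : HasDerivAt h
      (⟪gradient f (x + t • d), d⟫ - ⟪gradient f x, d⟫ - 2 * t * (L / 2 * ‖d‖ ^ 2)) t := by
    have hline : HasDerivAt (fun t : ℝ ↦ x + t • d) d t := by
      simpa using ((hasDerivAt_id t).smul_const d).const_add x
    have hf := (hdiff (x + t • d)).hasGradientAt.hasFDerivAt.comp_hasDerivAt t hline
    rw [InnerProductSpace.toDual_apply_apply] at hf
    have hlin := (hasDerivAt_id t).mul_const ⟪gradient f x, d⟫
    have hsq := (hasDerivAt_pow 2 t).mul_const (L / 2 * ‖d‖ ^ 2)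
    exact ((hf.sub hlin).sub hsq).congr_deriv (by simp)
  have hanti : AntitoneOn h (Icc 0 1) := by
    refine antitoneOn_of_deriv_nonpos (convex_Icc 0 1)
      (fun t _ ↦ (hderiv t).continuousAt.continuousWithinAt)
      (fun t _ ↦ (hderiv t).differentiableAt.differentiableWithinAt) fun t ht ↦ ?_
    rw [interior_Icc] at ht
    rw [(hderiv t).deriv, ← inner_sub_left]
    have hnorm : ‖gradient f (x + t • d) - gradient f x‖ ≤ L * (t * ‖d‖) := by
      simpa [norm_smul, abs_of_pos ht.1] using hlip (x + t • d) x
    have hinner := real_inner_le_norm (gradient f (x + t • d) - gradient f x) d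
    have := mul_le_mul_of_nonneg_right hnorm (norm_nonneg d)
    linarith
  have h01 := hanti (left_mem_Icc.2 zero_le_one) (right_mem_Icc.2 zero_le_one) zero_le_one
  simp only [h, one_smul, zero_smul, add_zero] at h01
  linarith

/-- A point `d` of the closed ball having `0` and `L⁻¹ • g` as antipodal points satisfies
`L * ‖d‖ ^ 2 ≤ ⟪g, d⟫`. -/
theorem mul_norm_sq_le_inner_of_norm_sub_smul_le {E : Type*} [NormedAddCommGroup E]
    [InnerProductSpace ℝ E] {L : ℝ} (hL : 0 < L) {g d : E}
    (h : ‖d - (2 * L)⁻¹ • g‖ ≤ ‖g‖ / (2 * L)) : L * ‖d‖ ^ 2 ≤ ⟪g, d⟫ := by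
  have hsq := pow_le_pow_left₀ (norm_nonneg _) h 2
  rw [norm_sub_sq_real, norm_smul, inner_smul_right, Real.norm_of_nonneg (by positivity),
    real_inner_comm] at hsq
  have hd : ‖d‖ ^ 2 ≤ ⟪g, d⟫ / L := by
    have h₁ : ((2 * L)⁻¹ * ‖g‖) ^ 2 = (‖g‖ / (2 * L)) ^ 2 := by ring
    have h₂ : 2 * ((2 * L)⁻¹ * ⟪g, d⟫) = ⟪g, d⟫ / L := by field_simp
    linarith
  rwa [le_div_iff₀' hL] at hd

/-- equation (25) in the paper: every point `z` of the ball
`B̄_{‖g‖/2L}(x̄ + g/2L)`, for `g = -∇f(x̄)`, satisfies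
`f(z) ≤ f(x̄) - (L/2)‖z - x̄‖²`. -/
theorem stmt10 {n : ℕ} (f : EuclideanSpace ℝ (Fin n) → ℝ) (L : ℝ) (hL : 0 < L)
    (hdiff : ∀ x, DifferentiableAt ℝ f x)
    (hlip : ∀ x y, ‖gradient f x - gradient f y‖ ≤ L * ‖x - y‖)
    (xbar : EuclideanSpace ℝ (Fin n))
    (g : EuclideanSpace ℝ (Fin n)) (hg : g = -gradient f xbar)
    (z : EuclideanSpace ℝ (Fin n))
    (hz : z ∈ Metric.closedBall (xbar + (2 * L)⁻¹ • g) (‖g‖ / (2 * L))) :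
    f z ≤ f xbar - L / 2 * ‖z - xbar‖ ^ 2 := by
  have hball : ‖(z - xbar) - (2 * L)⁻¹ • g‖ ≤ ‖g‖ / (2 * L) := by
    rwa [mem_closedBall, dist_eq_norm, ← sub_sub] at hz
  have hinner := mul_norm_sq_le_inner_of_norm_sub_smul_le hL hball
  have hdescent := le_add_inner_gradient_add_of_lipschitz_gradient hdiff hlip xbar (z - xbar)
  rw [add_sub_cancel] at hdescent
  rw [hg, inner_neg_left] at hinner
  linarith
end
end

section
/- Let f : ℝ^n → ℝ be differentiable with L-Lipschitz gradient (L > 0), let x̄ ∈ ℝ^n, set g = −∇f(x̄), let d ∈ ℝ^n with d ≠ 0 and ⟨g, d⟩ ≥ 0, and let y ∈ ℝ^n. Then for every β ≥ 0 such that y + βd lies in the closed ball of radius ⟨g, d⟩/(L‖d‖) centered at x̄, the derivative (d/dβ) f(y + βd) is ≤ 0. Consequently, if the whole segment {y + βd : 0 ≤ β ≤ β₀} lies in that ball, then f(y + β₀ d) ≤ f(y). -/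
open Set Metric RealInnerProductSpace

noncomputable section

/-- Lemma 1 of the paper: along a descent direction `d` for
`-g = ∇f(x̄)`, as long as the point stays in the ball of radius `⟪g, d⟫/(L‖d‖)`
around `x̄`, the map `β ↦ f(y + β d)` has nonpositive derivative; consequently `f`
decreases along the corresponding segment. -/
theorem stmt11 {n : ℕ} (f : EuclideanSpace ℝ (Fin n) → ℝ) (L : ℝ) (hL : 0 < L)
    (hdiff : ∀ x, DifferentiableAt ℝ f x)
    (hlip : ∀ x y, ‖gradient f x - gradient f y‖ ≤ L * ‖x - y‖)
    (xbar y d : EuclideanSpace ℝ (Fin n)) (hd : d ≠ 0)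
    (g : EuclideanSpace ℝ (Fin n)) (hg : g = -gradient f xbar)
    (hgd : 0 ≤ ⟪g, d⟫) :
    (∀ β : ℝ, 0 ≤ β →
      y + β • d ∈ Metric.closedBall xbar (⟪g, d⟫ / (L * ‖d‖)) →
      deriv (fun t : ℝ => f (y + t • d)) β ≤ 0) ∧
    (∀ β₀ : ℝ, 0 ≤ β₀ →
      (∀ β ∈ Set.Icc (0 : ℝ) β₀,
        y + β • d ∈ Metric.closedBall xbar (⟪g, d⟫ / (L * ‖d‖))) →
      f (y + β₀ • d) ≤ f y) := by
  have hderiv : ∀ t : ℝ, HasDerivAt (fun t : ℝ => f (y + t • d))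
      ⟪gradient f (y + t • d), d⟫ t := fun t => by
    have hline : HasDerivAt (fun t : ℝ => y + t • d) d t := by
      simpa using ((hasDerivAt_id t).smul_const d).const_add y
    exact (hdiff (y + t • d)).hasGradientAt.hasFDerivAt.comp_hasDerivAt t hline
  have hnonpos : ∀ β : ℝ, y + β • d ∈ Metric.closedBall xbar (⟪g, d⟫ / (L * ‖d‖)) →
      deriv (fun t : ℝ => f (y + t • d)) β ≤ 0 := fun β hβ => by
    rw [(hderiv β).deriv]
    have hball : ‖y + β • d - xbar‖ * (L * ‖d‖) ≤ ⟪g, d⟫ := by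
      rwa [mem_closedBall, dist_eq_norm,
        le_div_iff₀ (mul_pos hL (norm_pos_iff.mpr hd))] at hβ
    have hinner := real_inner_le_norm (gradient f (y + β • d) - gradient f xbar) d
    have hbound := mul_le_mul_of_nonneg_right (hlip (y + β • d) xbar) (norm_nonneg d)
    rw [inner_sub_left] at hinner
    rw [hg, inner_neg_left] at hball
    linarith
  refine ⟨fun β _ => hnonpos β, fun β₀ hβ₀ hseg => ?_⟩
  have hanti : AntitoneOn (fun t : ℝ => f (y + t • d)) (Icc 0 β₀) :=
    antitoneOn_of_deriv_nonpos (convex_Icc 0 β₀)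
      (fun t _ => (hderiv t).continuousAt.continuousWithinAt)
      (fun t _ => (hderiv t).differentiableAt.differentiableWithinAt)
      (fun t ht => hnonpos t (hseg t (interior_subset ht)))
  simpa using hanti (left_mem_Icc.mpr hβ₀) (right_mem_Icc.mpr hβ₀) hβ₀
end
end

section
/- Let q ∈ (0, 1) and let {a_j}_{j ≥ 0} be a sequence of real numbers with a_j ≥ 0, a_{j+1} ≤ a_j, and a_j ≤ q^j a_0 for all j ≥ 0. Then Σ_{j=0}^{∞} √(a_j − a_{j+1}) ≤ √(a_0 (1 − q)) / (1 − √q). -/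
/-- Weighted AM-GM for a square root. -/
theorem two_mul_mul_sqrt_le {s x d : ℝ} (hx : 0 < x) (hd : 0 ≤ d) :
    2 * s * √d ≤ s ^ 2 * x + d / x := by
  have h : s ^ 2 * x + d / x - 2 * s * √d = (s * x - √d) ^ 2 / x := by
    field_simp
    linear_combination -Real.sq_sqrt hd
  have : 0 ≤ (s * x - √d) ^ 2 / x := by positivity
  linarith

/-- Summation by parts of the AM-GM bounds for a sequence dominated by `(r ^ 2) ^ j * a 0`. -/
theorem two_mul_mul_sum_sqrt_sub_add_le {r s : ℝ} (hr0 : 0 < r) (hr1 : r < 1) {a : ℕ → ℝ}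
    (hs : s ^ 2 = a 0 * (1 - r ^ 2)) (hmono : ∀ j, a (j + 1) ≤ a j)
    (hdec : ∀ j, a j ≤ (r ^ 2) ^ j * a 0) (n : ℕ) :
    2 * s * ∑ j ∈ Finset.range n, √(a j - a (j + 1)) + a n / r ^ n ≤
      a 0 * ((1 + r) * (1 - r ^ n) + (1 + r - r ^ (n + 1))) := by
  induction n with
  | zero => simp
  | succ n ih =>
    have hx : 0 < r ^ n := by positivity
    have hsqrt := two_mul_mul_sqrt_le (s := s) hx (sub_nonneg.2 (hmono n))
    have htail : a (n + 1) / r ^ (n + 1) * (1 - r) ≤ a 0 * r ^ (n + 1) * (1 - r) := by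
      refine mul_le_mul_of_nonneg_right ?_ (by linarith)
      rw [div_le_iff₀ (by positivity)]
      exact (hdec (n + 1)).trans_eq (by ring)
    have hshift : a (n + 1) / r ^ n = a (n + 1) / r ^ (n + 1) * r := by
      field_simp
      ring
    rw [sub_div, hshift, hs] at hsqrt
    rw [Finset.sum_range_succ, mul_add]
    simp only [pow_succ] at *
    linarith

/-- equation (48) in the paper, via Karamata's inequality: if a
nonnegative non-increasing sequence satisfies `a_j ≤ q^j a_0` with `q ∈ (0,1)`, then
`Σ_{j=0}^∞ √(a_j - a_{j+1}) ≤ √(a_0 (1 - q)) / (1 - √q)`. -/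
theorem stmt15 (q : ℝ) (hq0 : 0 < q) (hq1 : q < 1)
    (a : ℕ → ℝ) (hnn : ∀ j, 0 ≤ a j) (hmono : ∀ j, a (j + 1) ≤ a j)
    (hdec : ∀ j, a j ≤ q ^ j * a 0) :
    ∑' j : ℕ, Real.sqrt (a j - a (j + 1)) ≤
      Real.sqrt (a 0 * (1 - q)) / (1 - Real.sqrt q) := by
  obtain h0 | h0 := (hnn 0).eq_or_lt
  · have ha : ∀ j, a j = 0 := fun j => le_antisymm (by simpa [← h0] using hdec j) (hnn j)
    simp [ha]
  set r := √q
  have hr0 : 0 < r := Real.sqrt_pos.2 hq0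
  have hqr : r ^ 2 = q := Real.sq_sqrt hq0.le
  have hr1 : r < 1 := by nlinarith
  have hpos : 0 < a 0 * (1 - q) := mul_pos h0 (by linarith)
  set s := √(a 0 * (1 - q))
  have hs0 : 0 < s := Real.sqrt_pos.2 hpos
  have hs : s ^ 2 = a 0 * (1 - r ^ 2) := by rw [hqr]; exact Real.sq_sqrt hpos.le
  refine Real.tsum_le_of_sum_range_le (fun _ => Real.sqrt_nonneg _) fun n => ?_
  have hsum := two_mul_mul_sum_sqrt_sub_add_le hr0 hr1 hs hmono (by simpa only [hqr] using hdec) n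
  have htail : 0 ≤ a n / r ^ n := div_nonneg (hnn n) (by positivity)
  have hrem : 0 ≤ a 0 * ((1 + r) * r ^ n + r ^ (n + 1)) := by positivity
  have hle : s * ∑ j ∈ Finset.range n, √(a j - a (j + 1)) ≤ a 0 * (1 + r) := by linarith
  rw [le_div_iff₀ (by linarith)]
  refine le_of_mul_le_mul_left ?_ hs0
  calc s * ((∑ j ∈ Finset.range n, √(a j - a (j + 1))) * (1 - r))
      = s * (∑ j ∈ Finset.range n, √(a j - a (j + 1))) * (1 - r) := by ring
    _ ≤ a 0 * (1 + r) * (1 - r) := mul_le_mul_of_nonneg_right hle (by linarith)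
    _ = s * s := by linear_combination -hs
end

section
/- Let Ω ⊆ ℝ^n be a compact convex set and f : ℝ^n → ℝ differentiable with L-Lipschitz gradient (L > 0). Let μ > 0 and x* ∈ Ω be such that ‖π(T_Ω(x), −∇f(x))‖² ≥ 2μ(f(x) − f(x*)) and f(x) ≥ f(x*) for all x ∈ Ω. Let K > 0 and let {x_k}_{k ≥ 0} ⊆ Ω and {x̃_k}_{k ≥ 0} ⊆ Ω be sequences such that for every k: (i) f(x_k) − f(x_{k+1}) ≥ (L/2)‖x_k − x_{k+1}‖²; (ii) ‖x_k − x_{k+1}‖ ≥ K‖π(T_Ω(x̃_k), −∇f(x̃_k))‖; (iii) f(x_{k+1}) ≤ f(x̃_k) ≤ f(x_k). Then, with q = (1 + μLK²)^{−1}, one has f(x_k) − f(x*) ≤ q^k (f(x_0) − f(x*)) for all k ≥ 0. -/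
open Set Metric RealInnerProductSpace

noncomputable section

/-- Theorem 1, rate \eqref{th:qdec}: under the KL inequality and the
SSC descent conditions (i)–(iii), the gap contracts linearly:
`f(x_k) - f(x*) ≤ q^k (f(x_0) - f(x*))` with `q = (1 + μLK²)⁻¹`. -/
theorem stmt16 {n : ℕ} (Ω : Set (EuclideanSpace ℝ (Fin n)))
    (hΩcp : IsCompact Ω) (hΩconv : Convex ℝ Ω)
    (f : EuclideanSpace ℝ (Fin n) → ℝ) (L : ℝ) (hL : 0 < L)
    (hdiff : ∀ x, DifferentiableAt ℝ f x)
    (hlip : ∀ x y, ‖gradient f x - gradient f y‖ ≤ L * ‖x - y‖)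
    (μ : ℝ) (hμ : 0 < μ)
    (xstar : EuclideanSpace ℝ (Fin n)) (hxstar : xstar ∈ Ω)
    (P : EuclideanSpace ℝ (Fin n) → EuclideanSpace ℝ (Fin n))
    (hP : ∀ x ∈ Ω, IsProjection (tangentCone Ω x) (-gradient f x) (P x))
    (hKL : ∀ x ∈ Ω, 2 * μ * (f x - f xstar) ≤ ‖P x‖ ^ 2)
    (hlb : ∀ x ∈ Ω, f xstar ≤ f x)
    (K : ℝ) (hK : 0 < K)
    (x xt : ℕ → EuclideanSpace ℝ (Fin n))
    (hxΩ : ∀ k, x k ∈ Ω) (hxtΩ : ∀ k, xt k ∈ Ω)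
    (h1 : ∀ k, L / 2 * ‖x k - x (k + 1)‖ ^ 2 ≤ f (x k) - f (x (k + 1)))
    (h2 : ∀ k, K * ‖P (xt k)‖ ≤ ‖x k - x (k + 1)‖)
    (h3 : ∀ k, f (x (k + 1)) ≤ f (xt k) ∧ f (xt k) ≤ f (x k))
    (q : ℝ) (hq : q = (1 + μ * L * K ^ 2)⁻¹) :
    ∀ k : ℕ, f (x k) - f xstar ≤ q ^ k * (f (x 0) - f xstar) := by
  have hc : 0 < 1 + μ * L * K ^ 2 := by positivity
  have contraction (k : ℕ) : f (x (k + 1)) - f xstar ≤ q * (f (x k) - f xstar) := by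
    have hsq : (K * ‖P (xt k)‖) ^ 2 ≤ ‖x k - x (k + 1)‖ ^ 2 :=
      pow_le_pow_left₀ (by positivity) (h2 k) 2
    have hdescent : (1 + μ * L * K ^ 2) * (f (x (k + 1)) - f xstar) ≤ f (x k) - f xstar := by
      have hgap : μ * L * K ^ 2 * (f (x (k + 1)) - f xstar) ≤ f (x k) - f (x (k + 1)) := calc
        μ * L * K ^ 2 * (f (x (k + 1)) - f xstar)
            ≤ μ * L * K ^ 2 * (f (xt k) - f xstar) := by
              gcongr
              exact (h3 k).1
        _ = L / 2 * K ^ 2 * (2 * μ * (f (xt k) - f xstar)) := by ring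
        _ ≤ L / 2 * K ^ 2 * ‖P (xt k)‖ ^ 2 := by
              gcongr
              exact hKL _ (hxtΩ k)
        _ = L / 2 * (K * ‖P (xt k)‖) ^ 2 := by ring
        _ ≤ L / 2 * ‖x k - x (k + 1)‖ ^ 2 := by gcongr
        _ ≤ f (x k) - f (x (k + 1)) := h1 k
      linarith
    rw [hq]
    exact (le_inv_mul_iff₀ hc).2 hdescent
  have hq0 : 0 ≤ q := hq ▸ (inv_pos.2 hc).le
  intro k
  induction k with
  | zero => simp
  | succ k ih =>
    calc f (x (k + 1)) - f xstar ≤ q * (f (x k) - f xstar) := contraction k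
      _ ≤ q * (q ^ k * (f (x 0) - f xstar)) := by gcongr
      _ = q ^ (k + 1) * (f (x 0) - f xstar) := by ring
end
end

section
/- Let Ω ⊆ ℝ^n be a compact convex set and f : ℝ^n → ℝ differentiable with L-Lipschitz gradient (L > 0). Let μ > 0 and x* ∈ Ω be such that ‖π(T_Ω(x), −∇f(x))‖² ≥ 2μ(f(x) − f(x*)) and f(x) ≥ f(x*) for all x ∈ Ω. Let K > 0 and let {x_k}_{k ≥ 0} ⊆ Ω and {x̃_k}_{k ≥ 0} ⊆ Ω be sequences such that for every k: (i) f(x_k) − f(x_{k+1}) ≥ (L/2)‖x_k − x_{k+1}‖²; (ii) ‖x_k − x_{k+1}‖ ≥ K‖π(T_Ω(x̃_k), −∇f(x̃_k))‖; (iii) f(x_{k+1}) ≤ f(x̃_k) ≤ f(x_k). Then, with q = (1 + μLK²)^{−1}, the sequence {x_k} converges to a point x̃* ∈ Ω with f(x̃*) = f(x*), and for every k ≥ 0: ‖x_k − x̃*‖ ≤ (√(2(1 − q)(f(x_0) − f(x*))) / (√L (1 − √q))) · q^{k/2}. -/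
open Set Metric RealInnerProductSpace

noncomputable section

/-- A telescoping bound with vanishing potential forces convergence, at the rate of the potential. -/
theorem exists_tendsto_of_dist_succ_le_sub {E : Type*} [MetricSpace E] [CompleteSpace E]
    {x : ℕ → E} {V : ℕ → ℝ} (hV0 : ∀ k, 0 ≤ V k)
    (hV : Filter.Tendsto V Filter.atTop (nhds 0))
    (hd : ∀ k, dist (x k) (x (k + 1)) ≤ V k - V (k + 1)) :
    ∃ a, Filter.Tendsto x Filter.atTop (nhds a) ∧ ∀ k, dist (x k) a ≤ V k := by
  have key : ∀ k m, k ≤ m → dist (x k) (x m) ≤ V k := by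
    intro k m hkm
    have : dist (x k) (x m) ≤ V k - V m := by
      induction m, hkm using Nat.le_induction with
      | base => simp
      | succ m _ ih => linarith [dist_triangle (x k) (x m) (x (m + 1)), hd m]
    linarith [hV0 m]
  obtain ⟨a, ha⟩ := cauchySeq_tendsto_of_complete (cauchySeq_of_le_tendsto_0' V key hV)
  refine ⟨a, ha, fun k => le_of_tendsto (tendsto_const_nhds.dist ha) ?_⟩
  filter_upwards [Filter.eventually_ge_atTop k] with m hm using key k m hm

/-- If a step `d` is controlled by the decrease from `α ^ 2` to `β ^ 2` and `β ≤ s * α`, then `d` is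
controlled by the decrease from `α` to `β`. -/
theorem le_mul_sub_of_sq_le_sq_sub_sq {L s M α β d : ℝ} (hL : 0 < L) (hs1 : s < 1)
    (hM0 : 0 ≤ M) (hM : L * (1 - s) * M ^ 2 = 2 * (1 + s)) (hα : 0 ≤ α)
    (hβα : β ≤ s * α) (hd : L / 2 * d ^ 2 ≤ α ^ 2 - β ^ 2) :
    d ≤ M * (α - β) := by
  have hsub : 0 ≤ α - β := by nlinarith
  have hpos : 0 < L * (1 - s) := mul_pos hL (by linarith)
  refine le_of_sq_le_sq ?_ (mul_nonneg hM0 hsub)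
  refine le_of_mul_le_mul_left ?_ hpos
  calc L * (1 - s) * d ^ 2 = 2 * (1 - s) * (L / 2 * d ^ 2) := by ring
    _ ≤ 2 * (1 - s) * (α ^ 2 - β ^ 2) := mul_le_mul_of_nonneg_left hd (by linarith)
    _ ≤ 2 * (1 + s) * (α - β) ^ 2 := by
      nlinarith [mul_nonneg hsub (sub_nonneg.2 hβα)]
    _ = L * (1 - s) * (M * (α - β)) ^ 2 := by rw [← hM]; ring

/-- Theorem 1, convergence of iterates \eqref{th:taillen}: under the
KL inequality and the SSC descent conditions (i)–(iii), the iterates converge to a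
point `x̃*` with `f(x̃*) = f(x*)`, at the rate
`‖x_k - x̃*‖ ≤ √(2(1-q)(f(x_0) - f(x*))) / (√L (1 - √q)) · q^{k/2}`. -/
theorem stmt17 {n : ℕ} (Ω : Set (EuclideanSpace ℝ (Fin n)))
    (hΩcp : IsCompact Ω) (hΩconv : Convex ℝ Ω)
    (f : EuclideanSpace ℝ (Fin n) → ℝ) (L : ℝ) (hL : 0 < L)
    (hdiff : ∀ x, DifferentiableAt ℝ f x)
    (hlip : ∀ x y, ‖gradient f x - gradient f y‖ ≤ L * ‖x - y‖)
    (μ : ℝ) (hμ : 0 < μ)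
    (xstar : EuclideanSpace ℝ (Fin n)) (hxstar : xstar ∈ Ω)
    (P : EuclideanSpace ℝ (Fin n) → EuclideanSpace ℝ (Fin n))
    (hP : ∀ x ∈ Ω, IsProjection (tangentCone Ω x) (-gradient f x) (P x))
    (hKL : ∀ x ∈ Ω, 2 * μ * (f x - f xstar) ≤ ‖P x‖ ^ 2)
    (hlb : ∀ x ∈ Ω, f xstar ≤ f x)
    (K : ℝ) (hK : 0 < K)
    (x xt : ℕ → EuclideanSpace ℝ (Fin n))
    (hxΩ : ∀ k, x k ∈ Ω) (hxtΩ : ∀ k, xt k ∈ Ω)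
    (h1 : ∀ k, L / 2 * ‖x k - x (k + 1)‖ ^ 2 ≤ f (x k) - f (x (k + 1)))
    (h2 : ∀ k, K * ‖P (xt k)‖ ≤ ‖x k - x (k + 1)‖)
    (h3 : ∀ k, f (x (k + 1)) ≤ f (xt k) ∧ f (xt k) ≤ f (x k))
    (q : ℝ) (hq : q = (1 + μ * L * K ^ 2)⁻¹) :
    ∃ xlim ∈ Ω, Filter.Tendsto x Filter.atTop (nhds xlim) ∧ f xlim = f xstar ∧
      ∀ k : ℕ, ‖x k - xlim‖ ≤
        Real.sqrt (2 * (1 - q) * (f (x 0) - f xstar)) /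
          (Real.sqrt L * (1 - Real.sqrt q)) * q ^ ((k : ℝ) / 2) := by
  have hc : 0 < μ * L * K ^ 2 := by positivity
  have hq0 : 0 < q := by rw [hq]; positivity
  have hq1 : q < 1 := by rw [hq]; exact inv_lt_one_of_one_lt₀ (by linarith)
  have hqc : q * (1 + μ * L * K ^ 2) = 1 := by rw [hq]; field_simp
  set s := Real.sqrt q with hs
  have hs0 : 0 ≤ s := Real.sqrt_nonneg q
  have hss : s ^ 2 = q := Real.sq_sqrt hq0.le
  have hs1 : s < 1 := by nlinarith
  have ha0 : ∀ k, 0 ≤ f (x k) - f xstar := fun k => sub_nonneg.2 (hlb _ (hxΩ k))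
  have hdec : ∀ k, f (x (k + 1)) - f xstar ≤ q * (f (x k) - f xstar) := by
    intro k
    have hP2 : K ^ 2 * ‖P (xt k)‖ ^ 2 ≤ ‖x k - x (k + 1)‖ ^ 2 := by
      rw [← mul_pow]
      exact pow_le_pow_left₀ (by positivity) (h2 k) 2
    have hgap : 2 * μ * (f (x (k + 1)) - f xstar) ≤ ‖P (xt k)‖ ^ 2 :=
      le_trans (by have := (h3 k).1; gcongr) (hKL _ (hxtΩ k))
    have hstep : μ * L * K ^ 2 * (f (x (k + 1)) - f xstar) ≤ f (x k) - f (x (k + 1)) :=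
      calc μ * L * K ^ 2 * (f (x (k + 1)) - f xstar)
          = L / 2 * (K ^ 2 * (2 * μ * (f (x (k + 1)) - f xstar))) := by ring
        _ ≤ L / 2 * (K ^ 2 * ‖P (xt k)‖ ^ 2) := by gcongr
        _ ≤ L / 2 * ‖x k - x (k + 1)‖ ^ 2 := by gcongr
        _ ≤ _ := h1 k
    calc f (x (k + 1)) - f xstar
        = q * (1 + μ * L * K ^ 2) * (f (x (k + 1)) - f xstar) := by rw [hqc, one_mul]
      _ = q * (f (x (k + 1)) - f xstar + μ * L * K ^ 2 * (f (x (k + 1)) - f xstar)) := by ring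
      _ ≤ q * (f (x k) - f xstar) := mul_le_mul_of_nonneg_left (by linarith) hq0.le
  set α : ℕ → ℝ := fun k => Real.sqrt (f (x k) - f xstar) with hα
  have hα0 : ∀ k, 0 ≤ α k := fun k => Real.sqrt_nonneg _
  have hαsq : ∀ k, α k ^ 2 = f (x k) - f xstar := fun k => Real.sq_sqrt (ha0 k)
  have hαdec : ∀ k, α (k + 1) ≤ s * α k := fun k => by
    rw [hs, hα, ← Real.sqrt_mul hq0.le]
    exact Real.sqrt_le_sqrt (hdec k)
  have hαpow : ∀ k, α k ≤ s ^ k * α 0 := by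
    intro k
    induction k with
    | zero => simp
    | succ k ih =>
      calc α (k + 1) ≤ s * α k := hαdec k
        _ ≤ s * (s ^ k * α 0) := by gcongr
        _ = s ^ (k + 1) * α 0 := by ring
  have hαlim : Filter.Tendsto α Filter.atTop (nhds 0) :=
    squeeze_zero hα0 hαpow
      (by simpa using (tendsto_pow_atTop_nhds_zero_of_lt_one hs0 hs1).mul_const (α 0))
  set M := Real.sqrt (2 * (1 - q)) / (Real.sqrt L * (1 - s)) with hMdef
  have hs1' : 0 < 1 - s := by linarith
  have hM0 : 0 ≤ M := by positivity
  have hM : L * (1 - s) * M ^ 2 = 2 * (1 + s) := by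
    rw [hMdef, div_pow, mul_pow, Real.sq_sqrt (by linarith), Real.sq_sqrt hL.le, ← hss]
    field_simp
    ring
  obtain ⟨xlim, hlim, hrate⟩ := exists_tendsto_of_dist_succ_le_sub (x := x)
    (V := fun k => M * α k) (fun k => mul_nonneg hM0 (hα0 k))
    (by simpa using hαlim.const_mul M) (fun k => by
      rw [dist_eq_norm, ← mul_sub]
      refine le_mul_sub_of_sq_le_sq_sub_sq hL hs1 hM0 hM (hα0 k) (hαdec k) ?_
      rw [hαsq, hαsq]
      linarith [h1 k])
  refine ⟨xlim, hΩcp.isClosed.mem_of_tendsto hlim (Filter.Eventually.of_forall hxΩ), hlim, ?_, ?_⟩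
  · have hgap : Filter.Tendsto (fun k => f (x k) - f xstar) Filter.atTop (nhds 0) := by
      simpa [hαsq] using hαlim.pow 2
    exact sub_eq_zero.1 (tendsto_nhds_unique
      (((hdiff xlim).continuousAt.tendsto.comp hlim).sub_const (f xstar)) hgap)
  · intro k
    have hqk : q ^ ((k : ℝ) / 2) = s ^ k := by
      rw [hs, Real.sqrt_eq_rpow, ← Real.rpow_natCast, ← Real.rpow_mul hq0.le]
      ring_nf
    rw [hqk, Real.sqrt_mul (by linarith), ← dist_eq_norm]
    calc dist (x k) xlim ≤ M * α k := hrate k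
      _ ≤ M * (s ^ k * α 0) := by gcongr; exact hαpow k
      _ = _ := by rw [hMdef]; ring
end
end

section
/- Let Ω ⊆ ℝ^n be a compact convex set and f : ℝ^n → ℝ differentiable with L-Lipschitz gradient (L > 0). Let K > 0 and let {x_k}_{k ≥ 0} ⊆ Ω and {x̃_k}_{k ≥ 0} ⊆ Ω be sequences such that for every k: (i) f(x_k) − f(x_{k+1}) ≥ (L/2)‖x_k − x_{k+1}‖²; (ii) ‖x_k − x_{k+1}‖ ≥ K‖π(T_Ω(x̃_k), −∇f(x̃_k))‖. Then for every k ≥ 0: min_{0 ≤ i ≤ k} ‖π(T_Ω(x̃_i), −∇f(x̃_i))‖ ≤ min_{0 ≤ i ≤ k} ‖x_{i+1} − x_i‖ / K ≤ √( 2(f(x_0) − f(x_{k+1})) / (K² L (k + 1)) ). -/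
open Set Metric RealInnerProductSpace

noncomputable section

/-- A sequence whose first `k + 1` decrements are all at least `c` drops by `(k + 1) * c`. -/
theorem succ_mul_le_sub_of_le_sub_succ {u : ℕ → ℝ} {c : ℝ} {k : ℕ}
    (h : ∀ i ≤ k, c ≤ u i - u (i + 1)) : ((k : ℝ) + 1) * c ≤ u 0 - u (k + 1) := by
  rw [← Finset.sum_range_sub' u (k + 1)]
  have := Finset.card_nsmul_le_sum (Finset.range (k + 1)) (fun i => u i - u (i + 1)) c
    fun i hi => h i (by simpa [Nat.lt_succ_iff] using hi)
  simpa using this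

/-- Theorem 2, rate \eqref{eq:qsqrk}: under the SSC descent conditions
(i)–(ii), the best stationarity measure among the first `k+1` iterates decays as
`O(1/√k)`. -/
theorem stmt18 {n : ℕ} (Ω : Set (EuclideanSpace ℝ (Fin n)))
    (hΩcp : IsCompact Ω) (hΩconv : Convex ℝ Ω)
    (f : EuclideanSpace ℝ (Fin n) → ℝ) (L : ℝ) (hL : 0 < L)
    (hdiff : ∀ x, DifferentiableAt ℝ f x)
    (hlip : ∀ x y, ‖gradient f x - gradient f y‖ ≤ L * ‖x - y‖)
    (K : ℝ) (hK : 0 < K)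
    (x xt : ℕ → EuclideanSpace ℝ (Fin n))
    (hxΩ : ∀ k, x k ∈ Ω) (hxtΩ : ∀ k, xt k ∈ Ω)
    (p : ℕ → EuclideanSpace ℝ (Fin n))
    (hp : ∀ k, IsProjection (tangentCone Ω (xt k)) (-gradient f (xt k)) (p k))
    (h1 : ∀ k, L / 2 * ‖x k - x (k + 1)‖ ^ 2 ≤ f (x k) - f (x (k + 1)))
    (h2 : ∀ k, K * ‖p k‖ ≤ ‖x k - x (k + 1)‖)
    (k : ℕ) :
    (⨅ i : Fin (k + 1), ‖p (i : ℕ)‖) ≤ (⨅ i : Fin (k + 1), ‖x ((i : ℕ) + 1) - x (i : ℕ)‖ / K) ∧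
      (⨅ i : Fin (k + 1), ‖x ((i : ℕ) + 1) - x (i : ℕ)‖ / K) ≤
        Real.sqrt (2 * (f (x 0) - f (x (k + 1))) / (K ^ 2 * L * (k + 1))) := by
  have hbdd {u : ℕ → ℝ} (hu : ∀ i, 0 ≤ u i) : BddBelow (range fun i : Fin (k + 1) => u i) :=
    ⟨0, by rintro _ ⟨i, rfl⟩; exact hu i⟩
  refine ⟨ciInf_mono (hbdd (u := fun i => ‖p i‖) fun i => norm_nonneg _) fun i => ?_, ?_⟩
  · rw [le_div_iff₀ hK, mul_comm, norm_sub_rev]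
    exact h2 i
  · set m := ⨅ i : Fin (k + 1), ‖x ((i : ℕ) + 1) - x (i : ℕ)‖ / K
    have hm0 : 0 ≤ m := Real.iInf_nonneg fun i => by positivity
    have hle (i : ℕ) (hi : i ≤ k) : m * K ≤ ‖x i - x (i + 1)‖ := by
      rw [norm_sub_rev, ← le_div_iff₀ hK]
      exact ciInf_le (hbdd (u := fun i => ‖x (i + 1) - x i‖ / K) fun i => by positivity)
        (⟨i, Nat.lt_succ_of_le hi⟩ : Fin (k + 1))
    have hsum := succ_mul_le_sub_of_le_sub_succ (u := fun i => f (x i))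
      (c := L / 2 * (m * K) ^ 2) (k := k) fun i hi => by
        refine le_trans ?_ (h1 i)
        have := hle i hi
        gcongr
    apply Real.le_sqrt_of_sq_le
    rw [le_div_iff₀ (by positivity)]
    linarith
end
end

section
/- Let Ω ⊆ ℝ^n be a compact convex set with diameter D, let y ∈ Ω, and let g ∈ ℝ^n. Then sup_{s ∈ Ω} ⟨g, s − y⟩ ≤ D · ‖π(T_Ω(y), g)‖. In particular, for a differentiable f, the Frank-Wolfe gap G(y) = max_{s ∈ Ω} ⟨−∇f(y), s − y⟩ satisfies G(y) ≤ D‖π(T_Ω(y), −∇f(y))‖. -/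
open Set Metric RealInnerProductSpace

noncomputable section

theorem add_smul_sub_mem_tangentCone {n : ℕ} {Ω : Set (EuclideanSpace ℝ (Fin n))}
    (hΩ : Convex ℝ Ω) {x s u : EuclideanSpace ℝ (Fin n)} (hs : s ∈ Ω)
    (hu : u ∈ tangentCone Ω x) {t : ℝ} (ht : 0 ≤ t) :
    u + t • (s - x) ∈ tangentCone Ω x := by
  refine map_mem_closure (f := fun v => v + t • (s - x)) (by fun_prop) hu ?_
  rintro v ⟨l, hl, hv⟩
  have hd : 0 < 1 + l * t := by positivity
  refine ⟨l / (1 + l * t), by positivity, ?_⟩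
  have hmem := hΩ hv hs (a := 1 / (1 + l * t)) (b := l * t / (1 + l * t))
    (by positivity) (by positivity) (by field_simp)
  convert hmem using 1
  match_scalars <;> field_simp <;> ring

theorem IsProjection.inner_sub_nonpos {n : ℕ} {C : Set (EuclideanSpace ℝ (Fin n))}
    {g p w : EuclideanSpace ℝ (Fin n)} (hp : IsProjection C g p)
    (hw : ∀ t : ℝ, 0 ≤ t → p + t • w ∈ C) : ⟪g - p, w⟫ ≤ 0 := by
  by_contra! hc
  set c := ⟪g - p, w⟫ with hc_def
  have hd : 0 < ‖w‖ ^ 2 + 1 := by positivity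
  set t := c / (‖w‖ ^ 2 + 1) with ht_def
  have ht : 0 < t := by positivity
  have hnorm := hp.2 _ (hw t ht.le)
  have hsq : ‖g - (p + t • w)‖ ^ 2 = ‖g - p‖ ^ 2 - 2 * (t * c) + t ^ 2 * ‖w‖ ^ 2 := by
    rw [← sub_sub, norm_sub_sq_real, inner_smul_right, norm_smul, mul_pow, Real.norm_eq_abs,
      sq_abs]
  have hle : ‖g - p‖ ^ 2 ≤ ‖g - (p + t • w)‖ ^ 2 := by gcongr
  have htc : t * (‖w‖ ^ 2 + 1) = c := by rw [ht_def]; field_simp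
  have htt : t ^ 2 * ‖w‖ ^ 2 = t * c - t ^ 2 := by rw [← htc]; ring
  nlinarith [mul_pos ht hc, sq_nonneg t]

theorem sSup_inner_sub_le_diam_mul_norm {n : ℕ} {Ω : Set (EuclideanSpace ℝ (Fin n))}
    (hΩb : Bornology.IsBounded Ω) (hΩ : Convex ℝ Ω) {y g p : EuclideanSpace ℝ (Fin n)}
    (hy : y ∈ Ω) (hp : IsProjection (tangentCone Ω y) g p) :
    sSup {r : ℝ | ∃ s ∈ Ω, r = ⟪g, s - y⟫} ≤ Metric.diam Ω * ‖p‖ := by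
  refine csSup_le ⟨_, y, hy, rfl⟩ ?_
  rintro r ⟨s, hs, rfl⟩
  have hgp : ⟪g - p, s - y⟫ ≤ 0 :=
    hp.inner_sub_nonpos fun t ht => add_smul_sub_mem_tangentCone hΩ hs hp.1 ht
  rw [inner_sub_left] at hgp
  have hdist : ‖s - y‖ ≤ Metric.diam Ω := by
    rw [← dist_eq_norm]
    exact Metric.dist_le_diam_of_mem hΩb hs hy
  calc ⟪g, s - y⟫ ≤ ⟪p, s - y⟫ := by linarith
    _ ≤ ‖p‖ * ‖s - y‖ := real_inner_le_norm _ _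
    _ ≤ ‖p‖ * Metric.diam Ω := by gcongr
    _ = Metric.diam Ω * ‖p‖ := mul_comm _ _

/-- Remark 4, equation \eqref{eq:gapsin}: the Frank-Wolfe gap at `y` is
bounded by the diameter times the norm of the projection of the (negative) gradient on
the tangent cone; stated both for a generic vector `g` and for `-∇f(y)`. -/
theorem stmt19 {n : ℕ} (Ω : Set (EuclideanSpace ℝ (Fin n)))
    (hΩcp : IsCompact Ω) (hΩconv : Convex ℝ Ω)
    (D : ℝ) (hD : D = Metric.diam Ω)
    (y : EuclideanSpace ℝ (Fin n)) (hy : y ∈ Ω)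
    (g p : EuclideanSpace ℝ (Fin n))
    (hp : IsProjection (tangentCone Ω y) g p)
    (f : EuclideanSpace ℝ (Fin n) → ℝ) (hdiff : ∀ x, DifferentiableAt ℝ f x)
    (p' : EuclideanSpace ℝ (Fin n))
    (hp' : IsProjection (tangentCone Ω y) (-gradient f y) p') :
    sSup {r : ℝ | ∃ s ∈ Ω, r = ⟪g, s - y⟫} ≤ D * ‖p‖ ∧
      sSup {r : ℝ | ∃ s ∈ Ω, r = ⟪-gradient f y, s - y⟫} ≤ D * ‖p'‖ := by
  subst hD
  exact ⟨sSup_inner_sub_le_diam_mul_norm hΩcp.isBounded hΩconv hy hp,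
    sSup_inner_sub_le_diam_mul_norm hΩcp.isBounded hΩconv hy hp'⟩
end
end
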